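/- arXiv:2109.14472 — 3 statements merged into one kernel-verified Lean document; each statement's English description precedes it below -/
import Mathlib

section
/- Let N ≥ 4 be an integer. If x_1,…,x_N and y_1,…,y_N are strictly positive real numbers such that ∑_{j=1}^N x_j = ∑_{j=1}^N y_j, ∏_{j=1}^N x_j = ∏_{j=1}^N y_j, and ∑_{j=1}^N 1/x_j = ∑_{j=1}^N 1/y_j, then max_j x_j < (N−2) · max_j y_j and min_j x_j < (N−2) · min_j y_j. -/
/-- The arithmetic–geometric mean inequality for finite products of nonnegative reals. -/
theorem Finset.prod_le_sum_div_card_pow {ι : Type*} (s : Finset ι) (u : ι → ℝ)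
    (hs : s.Nonempty) (hu : ∀ j ∈ s, 0 ≤ u j) :
    ∏ j ∈ s, u j ≤ ((∑ j ∈ s, u j) / s.card) ^ s.card := by
  have hc : (0 : ℝ) < s.card := by exact_mod_cast hs.card_pos
  have h := Real.geom_mean_le_arith_mean_weighted s (fun _ => (s.card : ℝ)⁻¹) u
    (fun _ _ => by positivity) (by simp [hc.ne']) hu
  rw [Real.finsetProd_rpow s u hu, ← Finset.mul_sum] at h
  have hp : 0 ≤ ∏ j ∈ s, u j := Finset.prod_nonneg hu
  have h' := pow_le_pow_left₀ (Real.rpow_nonneg hp _) h s.card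
  rwa [Real.rpow_inv_natCast_pow hp hs.card_pos.ne', inv_mul_eq_div] at h'

/-- The Weierstrass product inequality. -/
theorem Finset.sum_sub_card_add_one_le_prod {ι : Type*} (s : Finset ι) (v : ι → ℝ)
    (h0 : ∀ j ∈ s, 0 ≤ v j) (h1 : ∀ j ∈ s, v j ≤ 1) :
    ∑ j ∈ s, v j - s.card + 1 ≤ ∏ j ∈ s, v j := by
  classical
  induction s using Finset.induction_on with
  | empty => simp
  | insert i s hi ih =>
    simp only [Finset.mem_insert, forall_eq_or_imp] at h0 h1
    rw [Finset.sum_insert hi, Finset.prod_insert hi, Finset.card_insert_of_notMem hi]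
    have h := ih h0.2 h1.2
    have hp : ∏ j ∈ s, v j ≤ 1 := Finset.prod_le_one h0.2 h1.2
    push_cast
    nlinarith [mul_nonneg (sub_nonneg.2 h1.1) (sub_nonneg.2 hp)]

/-- Numbers in `[c, 1]` with total deficit `k * (1 - c)` from `1` have product at least `c ^ k`. -/
theorem Finset.pow_le_prod_of_sum_eq {ι : Type*} (s : Finset ι) (v : ι → ℝ) (c : ℝ) (k : ℕ)
    (hc : 0 < c) (h0 : ∀ j ∈ s, c ≤ v j) (h1 : ∀ j ∈ s, v j ≤ 1) (hc1 : c ≤ 1)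
    (hsum : ∑ j ∈ s, (1 - v j) = k * (1 - c)) :
    c ^ k ≤ ∏ j ∈ s, v j := by
  rcases hc1.eq_or_lt with rfl | hlt
  · rw [one_pow]
    exact (Finset.prod_eq_one fun j hj => le_antisymm (h1 j hj) (h0 j hj)).ge
  have hd : 0 < 1 - c := sub_pos.2 hlt
  have hw : ∑ j ∈ s, (1 - v j) / (1 - c) = k := by
    rw [← Finset.sum_div, hsum, mul_div_assoc, div_self hd.ne', mul_one]
  rw [← Real.rpow_natCast, ← hw, Real.rpow_sum_of_pos hc]
  refine Finset.prod_le_prod (fun j _ => Real.rpow_nonneg hc.le _) fun j hj => ?_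
  have hb := rpow_one_add_le_one_add_mul_self (s := c - 1) (p := (1 - v j) / (1 - c))
    (by linarith) (div_nonneg (by linarith [h1 j hj]) hd.le)
    ((div_le_one hd).2 (by linarith [h0 j hj]))
  rw [add_sub_cancel] at hb
  refine hb.trans_eq ?_
  field_simp
  ring

/-- The numerical inequality behind `false_of_lt_min` for families of four numbers. -/
theorem two_mul_sub_lt_add_of_add_le_one {p q : ℝ} (hp : 0 < p) (hpq : p ≤ q) (hs : p + q ≤ 1) :
    2 * (p * (2 * q + p)) - 5 * p ^ 2 * q * (p + q) < p + q := by
  obtain ⟨s, rfl⟩ : ∃ s, q = s - p := ⟨p + q, by ring⟩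
  obtain ⟨z, rfl⟩ : ∃ z, p = z * s := ⟨p / s, by
    rw [div_mul_cancel₀]
    linarith⟩
  have hs0 : 0 < s := by linarith
  have hs1 : s ≤ 1 := by linarith
  have hz0 : 0 < z := pos_of_mul_pos_left hp hs0.le
  have hz : z ≤ 1 / 2 := by
    refine le_of_mul_le_mul_right ?_ hs0
    linarith
  have hcube : 2.43 * s - 1.458 ≤ s ^ 3 := by
    nlinarith [mul_nonneg (sq_nonneg (s - 0.9)) (by linarith : 0 ≤ s + 1.8)]
  have hB0 : 0 ≤ 5 * z ^ 2 * (1 - z) := by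
    have : 0 ≤ 1 - z := by linarith
    positivity
  have hB1 : 5 * z ^ 2 * (1 - z) ≤ 5 / 8 := by
    nlinarith [mul_nonneg hz0.le (sub_nonneg.2 hz),
      mul_nonneg (mul_nonneg hz0.le hz0.le) (sub_nonneg.2 hz)]
  have hA : 4 * z - 2 * z ^ 2 - 0.972 * (5 * z ^ 2 * (1 - z)) < 1 := by
    nlinarith [mul_nonneg hz0.le (sub_nonneg.2 hz),
      mul_nonneg (mul_nonneg hz0.le hz0.le) (sub_nonneg.2 hz),
      mul_nonneg hz0.le (sq_nonneg (1 / 2 - z))]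
  have hf : (4 * z - 2 * z ^ 2) * s - 5 * z ^ 2 * (1 - z) * s ^ 3 < 1 := by
    nlinarith [mul_le_mul_of_nonneg_left hcube hB0, mul_nonneg hB0 (sub_nonneg.2 hs1),
      mul_lt_mul_of_pos_right hA hs0]
  nlinarith [mul_lt_mul_of_pos_right hf hs0]

/-- The numerical contradiction behind `false_of_min_le` for families of four numbers. -/
theorem false_of_deficit_bounds {τ δ : ℝ} (hτ0 : 0 < τ) (hτ2 : τ ≤ 2) (hδ1 : δ ≤ 1)
    (hcase : δ ≤ τ / 2) (hτsq : τ - δ ≤ τ ^ 2 / 2) (hτδ1 : τ - δ ≤ 1)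
    (hτδ : 27 * (δ * (τ - δ)) ≤ 2 * τ ^ 3) : False := by
  rcases le_total τ (8 / 5) with h | h
  · have := mul_nonneg (show 0 ≤ δ - (τ - τ ^ 2 / 2) by linarith)
      (show 0 ≤ τ ^ 2 / 2 - δ by linarith)
    nlinarith only [this, hτδ, pow_pos hτ0 3, mul_nonneg (sub_nonneg.2 h) (pow_pos hτ0 3).le]
  · have := mul_nonneg (show 0 ≤ δ - (τ - 1) by linarith) (sub_nonneg.2 hδ1)
    nlinarith only [this, hτδ, h, hτ2, mul_nonneg (sub_nonneg.2 h) (sub_nonneg.2 hτ2),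
      mul_nonneg (mul_nonneg (sub_nonneg.2 h) (sub_nonneg.2 hτ2)) hτ0.le]

/-- The case in which the second family has the larger minimum. -/
theorem false_of_min_le {n : ℕ} (hn : 2 ≤ n) {a r δ σ Q P τ : ℝ} (hσ : 0 < σ) (hQ : 0 < Q)
    (hP : 0 < P) (ha0 : 0 < a) (hδ : 0 < δ) (hδ1 : δ ≤ 1) (hτ2 : τ ≤ 2) (hστ : σ ≤ τ)
    (haσ : a * σ ≤ n * τ) (hamgm : Q ≤ (σ / n) ^ n)
    (hcube : 3 ≤ n → (n : ℝ) ^ 3 * (a * Q) ≤ a * σ * σ ^ 2)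
    (hprod : a * (r * Q) = δ * P) (hprodx : 27 * (δ * P) ≤ 2 * τ ^ 3)
    (hPτ : τ - δ ≤ P) (hτδ1 : τ - δ ≤ 1) (hcase : δ ≤ τ / 2) (hrδ : r ≤ δ) : False := by
  have hτ0 : 0 < τ := hσ.trans_le hστ
  have hPQ : P ≤ a * Q := by
    refine le_of_mul_le_mul_left ?_ hδ
    nlinarith only [hprod, mul_le_mul_of_nonneg_right hrδ (mul_pos ha0 hQ).le]
  rcases hn.eq_or_lt with rfl | h3
  · push_cast at haσ hamgm
    have hτsq : τ - δ ≤ τ ^ 2 / 2 := by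
      have : a * σ * σ ≤ 2 * τ * τ := by gcongr
      nlinarith only [this, hPτ, hPQ, mul_le_mul_of_nonneg_left hamgm ha0.le]
    exact false_of_deficit_bounds hτ0 hτ2 hδ1 hcase hτsq hτδ1
      (by nlinarith only [hprodx, mul_le_mul_of_nonneg_left hPτ hδ.le])
  · have h3' : (3 : ℝ) ≤ n := by exact_mod_cast h3
    have h1 : a * σ * σ ^ 2 ≤ n * τ * τ ^ 2 := by gcongr
    have h2 : (n : ℝ) ^ 2 * P ≤ τ ^ 3 := by
      refine le_of_mul_le_mul_left ?_ (show (0 : ℝ) < n by linarith)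
      nlinarith only [h1, hcube h3,
        mul_le_mul_of_nonneg_left hPQ (show (0 : ℝ) ≤ (n : ℝ) ^ 3 by positivity)]
    have h4 : (9 : ℝ) ≤ (n : ℝ) ^ 2 := by nlinarith only [h3']
    nlinarith only [h2, hPτ, hcase, hτ0, mul_le_mul_of_nonneg_right h4 hP.le,
      mul_nonneg hτ0.le (mul_nonneg hτ0.le (sub_nonneg.2 hτ2)),
      mul_nonneg hτ0.le (sub_nonneg.2 hτ2)]

/-- The case in which the first family has the larger minimum. -/
theorem false_of_lt_min {n : ℕ} (hn : 2 ≤ n) {a r δ σ Q T P K e : ℝ} (ha : (n : ℝ) ≤ a)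
    (hr : 0 < r) (hδ : 0 < δ) (hσ : 0 < σ) (hQ : 0 < Q) (he1 : e ≤ 1) (hσe : a + σ < n + e)
    (heP : e ≤ P) (hrσ : n * r ≤ σ) (hK : (n : ℝ) + 1 ≤ K) (hT : r * T ≤ n)
    (hcube : 3 ≤ n → (n : ℝ) ^ 3 * (a * Q) ≤ a * σ * σ ^ 2)
    (hpair : n = 2 → ∃ p q : ℝ, r ≤ p ∧ p ≤ q ∧ σ = p + q ∧ Q = p * q ∧ T = p⁻¹ + q⁻¹)
    (hprod : a * (r * Q) = δ * P) (hharm : a⁻¹ + (r⁻¹ + T) = δ⁻¹ + K) : False := by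
  have hn' : (2 : ℝ) ≤ n := by exact_mod_cast hn
  have ha0 : 0 < a := by linarith
  have he0 : 0 < e := by linarith
  have hPeq : P = a * Q * (1 + r / a + r * T - r * K) := by
    have hd : δ⁻¹ = a⁻¹ + (r⁻¹ + T) - K := by linarith
    calc P = δ⁻¹ * (δ * P) := by field_simp
      _ = (a⁻¹ + (r⁻¹ + T) - K) * (a * (r * Q)) := by rw [hd, hprod]
      _ = _ := by
        field_simp
        ring
  have haσ : a * σ ≤ n * e := by
    nlinarith only [ha0, hσe, mul_nonneg (sub_nonneg.2 ha) (show 0 ≤ a - e by linarith),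
      mul_lt_mul_of_pos_left hσe ha0]
  have hσ1 : σ ≤ 1 := by linarith
  have hr1 : r ≤ 1 := by nlinarith only [hrσ, hσ1, hr, hn']
  rcases hn.eq_or_lt with rfl | h3
  · obtain ⟨p, q, hrp, hpq, rfl, rfl, rfl⟩ := hpair rfl
    push_cast at ha haσ hK
    have hp : 0 < p := by linarith
    have hq : 0 < q := by linarith
    have hPle : P ≤ a * (p * q) * (1 + r / a + r * (p⁻¹ + q⁻¹) - r * 3) := by
      rw [hPeq]
      gcongr
      linarith
    have hexp : a * (p * q) * (1 + r / a + r * (p⁻¹ + q⁻¹) - r * 3)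
        = a * p * q + r * (p * q + a * (p + q - 3 * (p * q))) := by
      field_simp
      ring
    have hmono : r * (p * q + a * (p + q - 3 * (p * q)))
        ≤ p * (p * q + a * (p + q - 3 * (p * q))) := by
      refine mul_le_mul_of_nonneg_right hrp ?_
      have : 0 ≤ p + q - 3 * (p * q) := by
        nlinarith only [sq_nonneg (p - q), hσ, hσ1, mul_nonneg hσ.le (sub_nonneg.2 hσ1)]
      positivity
    have hmain : e ≤ a * (p * (2 * q + p)) - 5 * p ^ 2 * q := by
      nlinarith only [heP, hPle, hexp, hmono,
        mul_le_mul_of_nonneg_right ha (mul_pos (mul_pos hp hp) hq).le]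
    have hmain' : e * (p + q) ≤ 2 * e * (p * (2 * q + p)) - 5 * p ^ 2 * q * (p + q) := by
      nlinarith only [mul_le_mul_of_nonneg_right hmain (add_pos hp hq).le,
        mul_le_mul_of_nonneg_right haσ (show 0 ≤ p * (2 * q + p) by positivity)]
    have : e * (5 * p ^ 2 * q * (p + q)) ≤ 1 * (5 * p ^ 2 * q * (p + q)) := by gcongr
    nlinarith only [this, hmain',
      mul_lt_mul_of_pos_left (two_mul_sub_lt_add_of_add_le_one hp hpq hσ1) he0]
  · have h3' : (3 : ℝ) ≤ n := by exact_mod_cast h3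
    have hra : r / a ≤ 1 := (div_le_one ha0).2 (by linarith)
    have hrK : 0 ≤ r * K := mul_nonneg hr.le (by linarith)
    have hPle : P ≤ a * Q * (n + 2) := by
      rw [hPeq]
      gcongr
      linarith
    have h1 : a * σ * σ ^ 2 ≤ n * e * 1 ^ 2 := by gcongr
    have h2 : (n : ℝ) ^ 2 * (a * Q) ≤ e := by
      refine le_of_mul_le_mul_left ?_ (show (0 : ℝ) < n by linarith)
      nlinarith only [h1, hcube h3]
    have h4 : (n : ℝ) + 2 < (n : ℝ) ^ 2 := by nlinarith only [h3']
    nlinarith only [h2, hPle, heP, mul_lt_mul_of_pos_right h4 (mul_pos ha0 hQ)]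

/-- The core estimate: `a` is a large member of the first family and `r` the smallest of the others,
`δ` is the smallest member of the second family, whose members are at most `1`. -/
theorem false_of_equal_means {ι : Type*} (s t : Finset ι) (n : ℕ) (hn : 2 ≤ n)
    (hs : s.card = n) (ht : t.card = n + 1) (u v : ι → ℝ) (a r δ : ℝ)
    (hr : 0 < r) (hu : ∀ j ∈ s, r ≤ u j) (ha : (n : ℝ) ≤ a) (hδ : 0 < δ)
    (hv : ∀ j ∈ t, δ ≤ v j) (hv1 : ∀ j ∈ t, v j ≤ 1)
    (hsum : a + (r + ∑ j ∈ s, u j) = δ + ∑ j ∈ t, v j)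
    (hprod : a * (r * ∏ j ∈ s, u j) = δ * ∏ j ∈ t, v j)
    (hharm : a⁻¹ + (r⁻¹ + ∑ j ∈ s, (u j)⁻¹) = δ⁻¹ + ∑ j ∈ t, (v j)⁻¹) : False := by
  have hn' : (2 : ℝ) ≤ n := by exact_mod_cast hn
  have hup : ∀ j ∈ s, 0 < u j := fun j hj => hr.trans_le (hu j hj)
  have hvp : ∀ j ∈ t, 0 < v j := fun j hj => hδ.trans_le (hv j hj)
  have hsne : s.Nonempty := Finset.card_pos.1 (by omega)
  have htne : t.Nonempty := Finset.card_pos.1 (by omega)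
  have hδ1 : δ ≤ 1 := by
    obtain ⟨j, hj⟩ := htne
    exact (hv j hj).trans (hv1 j hj)
  have hamgm := Finset.prod_le_sum_div_card_pow s u hsne fun j hj => (hup j hj).le
  have hamgm' := Finset.prod_le_sum_div_card_pow (Finset.insertNone s) (fun o => o.elim r u)
    ⟨none, by simp⟩ (by
      intro o ho
      cases o with
      | none => exact hr.le
      | some j => exact (hup j (by simpa using ho)).le)
  have hweier := Finset.sum_sub_card_add_one_le_prod t v (fun j hj => (hvp j hj).le) hv1
  have hE : ∑ j ∈ t, v j ≤ n + 1 := by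
    have := Finset.sum_le_card_nsmul t v 1 hv1
    simpa [ht] using this
  have hsq : ∀ c : ℝ, 0 < c → c ≤ δ → δ + ∑ j ∈ t, v j = n + 2 * c →
      c ^ 2 ≤ δ * ∏ j ∈ t, v j := by
    intro c hc hcδ h
    have := Finset.pow_le_prod_of_sum_eq (Finset.insertNone t) (fun o => o.elim δ v) c 2 hc
      (by
        intro o ho
        cases o with
        | none => exact hcδ
        | some j => exact hcδ.trans (hv j (by simpa using ho)))
      (by
        intro o ho
        cases o with
        | none => exact hδ1
        | some j => exact hv1 j (by simpa using ho))
      (hcδ.trans hδ1)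
      (by
        rw [Finset.sum_insertNone]
        simp only [Option.elim, Finset.sum_sub_distrib, Finset.sum_const, ht]
        push_cast
        simp
        linarith)
    simpa [Finset.prod_insertNone] using this
  have hK : (n : ℝ) + 1 ≤ ∑ j ∈ t, (v j)⁻¹ := by
    have := Finset.card_nsmul_le_sum t (fun j => (v j)⁻¹) 1
      fun j hj => (one_le_inv₀ (hvp j hj)).2 (hv1 j hj)
    simpa [ht] using this
  have hT : r * ∑ j ∈ s, (u j)⁻¹ ≤ n := by
    rw [Finset.mul_sum]
    have := Finset.sum_le_card_nsmul s (fun j => r * (u j)⁻¹) 1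
      fun j hj => by
        rw [← div_eq_mul_inv]
        exact (div_le_one (hup j hj)).2 (hu j hj)
    simpa [hs] using this
  have hrσ : n * r ≤ ∑ j ∈ s, u j := by
    have := Finset.card_nsmul_le_sum s u r hu
    simpa [hs] using this
  have hpair : n = 2 → ∃ p q : ℝ, r ≤ p ∧ p ≤ q ∧ ∑ j ∈ s, u j = p + q ∧
      ∏ j ∈ s, u j = p * q ∧ ∑ j ∈ s, (u j)⁻¹ = p⁻¹ + q⁻¹ := by
    intro h2
    classical
    obtain ⟨i, j, hij, rfl⟩ := Finset.card_eq_two.1 (hs.trans h2)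
    rcases le_total (u i) (u j) with h | h
    · exact ⟨u i, u j, hu i (by simp), h, by simp [Finset.sum_pair hij],
        by simp [Finset.prod_pair hij], by simp [Finset.sum_pair hij]⟩
    · exact ⟨u j, u i, hu j (by simp), h, by rw [Finset.sum_pair hij, add_comm],
        by rw [Finset.prod_pair hij, mul_comm], by rw [Finset.sum_pair hij, add_comm]⟩
  have hQ : 0 < ∏ j ∈ s, u j := Finset.prod_pos hup
  have hP : 0 < ∏ j ∈ t, v j := Finset.prod_pos hvp
  rw [hs] at hamgm
  rw [Finset.sum_insertNone, Finset.prod_insertNone, Finset.card_insertNone, hs] at hamgm'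
  rw [ht] at hweier
  simp only [Option.elim] at hamgm'
  push_cast at hamgm' hweier
  generalize ∑ j ∈ s, u j = σ at *
  generalize ∏ j ∈ s, u j = Q at *
  generalize ∑ j ∈ s, (u j)⁻¹ = T at *
  generalize ∑ j ∈ t, v j = E at *
  generalize ∏ j ∈ t, v j = P at *
  generalize ∑ j ∈ t, (v j)⁻¹ = K at *
  have hσ : 0 < σ := by nlinarith
  have ha0 : 0 < a := by linarith
  obtain ⟨τ, hτ⟩ : ∃ τ, τ = σ + r + (a - n) := ⟨_, rfl⟩
  have hτ2 : τ ≤ 2 := by linarith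
  have hτ0 : 0 < τ := by linarith
  -- the product of `a` and the remaining sum is largest when `a` is smallest
  have haσ : a * (σ + r) ≤ n * τ := by
    rw [hτ]
    nlinarith [mul_nonneg (sub_nonneg.2 ha) (show 0 ≤ a - (σ + r) by linarith)]
  have hprodx : 27 * (δ * P) ≤ 2 * τ ^ 3 := by
    have hw0 : 0 ≤ (r + σ) / ((n : ℝ) + 1) := by positivity
    have hw1 : (r + σ) / ((n : ℝ) + 1) ≤ 1 := (div_le_one (by positivity)).2 (by linarith)
    have hw := hamgm'.trans (pow_le_pow_of_le_one hw0 hw1 (show 3 ≤ n + 1 by omega))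
    rw [div_pow, le_div_iff₀ (by positivity)] at hw
    have hn3 : 27 * (n : ℝ) ≤ 2 * ((n : ℝ) + 1) ^ 3 := by
      nlinarith [mul_nonneg (sub_nonneg.2 hn') (sub_nonneg.2 hn'),
        pow_pos (by linarith : (0 : ℝ) < n) 3]
    have hle : a * (r + σ) ^ 3 ≤ n * τ ^ 3 := by
      calc a * (r + σ) ^ 3 = a * (σ + r) * (r + σ) ^ 2 := by ring
        _ ≤ n * τ * τ ^ 2 := by gcongr; linarith
        _ = n * τ ^ 3 := by ring
    have hmul : δ * P * ((n : ℝ) + 1) ^ 3 ≤ n * τ ^ 3 := by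
      rw [← hprod, mul_assoc]
      exact (mul_le_mul_of_nonneg_left hw ha0.le).trans hle
    have h3 : 0 < ((n : ℝ) + 1) ^ 3 := by positivity
    refine le_of_mul_le_mul_right ?_ h3
    nlinarith [mul_le_mul_of_nonneg_right hn3 (pow_pos hτ0 3).le]
  have hcube : 3 ≤ n → (n : ℝ) ^ 3 * (a * Q) ≤ a * σ * σ ^ 2 := by
    intro h3
    have hw1 : σ / (n : ℝ) ≤ 1 := (div_le_one (by positivity)).2 (by linarith)
    have hw := hamgm.trans (pow_le_pow_of_le_one (by positivity) hw1 h3)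
    rw [div_pow, le_div_iff₀ (by positivity)] at hw
    nlinarith [mul_le_mul_of_nonneg_left hw ha0.le]
  rcases lt_or_ge (τ / 2) δ with hcase | hcase
  · have := hsq (τ / 2) (by positivity) hcase.le (by linarith)
    nlinarith [sq_pos_of_pos hτ0]
  rcases le_or_gt r δ with hrδ | hrδ
  · exact false_of_min_le hn hσ hQ hP ha0 hδ hδ1 hτ2 (by linarith)
      (le_trans (mul_le_mul_of_nonneg_left (by linarith) ha0.le) haσ) hamgm hcube hprod hprodx
      (by linarith) (by linarith) hcase hrδ
  · exact false_of_lt_min (e := E - n) hn ha hr hδ hσ hQ (by linarith) (by linarith)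
      (by linarith) hrσ hK hT hcube hpair hprod hharm

/-- If two families of `N` positive numbers have equal arithmetic, geometric and harmonic means,
every member of one is less than `N - 2` times any upper bound of the other. -/
theorem lt_mul_of_equal_means {N : ℕ} (hN : 4 ≤ N) {x y : Fin N → ℝ}
    (hx : ∀ j, 0 < x j) (hy : ∀ j, 0 < y j) (hsum : ∑ j, x j = ∑ j, y j)
    (hprod : ∏ j, x j = ∏ j, y j) (hharm : ∑ j, (x j)⁻¹ = ∑ j, (y j)⁻¹)
    {M : ℝ} (hM : ∀ j, y j ≤ M) (i : Fin N) :
    x i < ((N : ℝ) - 2) * M := by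
  by_contra! hcon
  have hM0 : 0 < M := (hy i).trans_le (hM i)
  obtain ⟨k, hk, hkmin⟩ := Finset.exists_min_image (Finset.univ.erase i) x
    (Finset.card_pos.1 (by
      rw [Finset.card_erase_of_mem (Finset.mem_univ i), Finset.card_univ, Fintype.card_fin]
      omega))
  obtain ⟨l, -, hlmin⟩ := Finset.exists_min_image Finset.univ y ⟨i, Finset.mem_univ i⟩
  have hl : l ∈ Finset.univ := Finset.mem_univ l
  have hi' : i ∈ Finset.univ := Finset.mem_univ i
  refine false_of_equal_means ((Finset.univ.erase i).erase k) (Finset.univ.erase l) (N - 2)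
    (by omega) ?_ ?_ (fun j => x j / M) (fun j => y j / M) (x i / M) (x k / M) (y l / M)
    (div_pos (hx k) hM0) ?_ ?_ (div_pos (hy l) hM0) ?_ ?_ ?_ ?_ ?_
  · rw [Finset.card_erase_of_mem hk, Finset.card_erase_of_mem hi', Finset.card_univ,
      Fintype.card_fin]
    omega
  · rw [Finset.card_erase_of_mem hl, Finset.card_univ, Fintype.card_fin]
    omega
  · intro j hj
    have := hkmin j (Finset.mem_of_mem_erase hj)
    gcongr
  · rw [le_div_iff₀ hM0, Nat.cast_sub (by omega)]
    exact_mod_cast hcon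
  · intro j _
    have := hlmin j (Finset.mem_univ j)
    gcongr
  · exact fun j _ => (div_le_one hM0).2 (hM j)
  · rw [Finset.add_sum_erase _ (fun j => x j / M) hk,
      Finset.add_sum_erase _ (fun j => x j / M) hi',
      Finset.add_sum_erase _ (fun j => y j / M) hl, ← Finset.sum_div, ← Finset.sum_div, hsum]
  · rw [Finset.mul_prod_erase _ (fun j => x j / M) hk,
      Finset.mul_prod_erase _ (fun j => x j / M) hi',
      Finset.mul_prod_erase _ (fun j => y j / M) hl, Finset.prod_div_distrib,
      Finset.prod_div_distrib, hprod]
  · rw [Finset.add_sum_erase _ (fun j => (x j / M)⁻¹) hk,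
      Finset.add_sum_erase _ (fun j => (x j / M)⁻¹) hi',
      Finset.add_sum_erase _ (fun j => (y j / M)⁻¹) hl]
    simp only [inv_div, div_eq_mul_inv M, ← Finset.mul_sum, hharm]

theorem four_mean_corollary (N : ℕ) (hN : 4 ≤ N) (x y : Fin N → ℝ)
    (hx : ∀ j, 0 < x j) (hy : ∀ j, 0 < y j)
    (hsum : ∑ j, x j = ∑ j, y j)
    (hprod : ∏ j, x j = ∏ j, y j)
    (hharm : ∑ j, (x j)⁻¹ = ∑ j, (y j)⁻¹) :
    Finset.univ.sup' ⟨⟨0, by omega⟩, Finset.mem_univ _⟩ x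
        < ((N : ℝ) - 2) * Finset.univ.sup' ⟨⟨0, by omega⟩, Finset.mem_univ _⟩ y
      ∧ Finset.univ.inf' ⟨⟨0, by omega⟩, Finset.mem_univ _⟩ x
        < ((N : ℝ) - 2) * Finset.univ.inf' ⟨⟨0, by omega⟩, Finset.mem_univ _⟩ y := by
  have hne : (Finset.univ : Finset (Fin N)).Nonempty := ⟨⟨0, by omega⟩, Finset.mem_univ _⟩
  constructor
  · obtain ⟨i, -, hi⟩ := Finset.exists_mem_eq_sup' hne x
    rw [hi]
    exact lt_mul_of_equal_means hN hx hy hsum hprod hharm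
      (fun j => Finset.le_sup' y (Finset.mem_univ j)) i
  · obtain ⟨k, -, hk⟩ := Finset.exists_mem_eq_inf' hne x
    obtain ⟨i, -, hi⟩ := Finset.exists_mem_eq_inf' hne y
    have hkmin : ∀ j, x k ≤ x j := fun j => hk ▸ Finset.inf'_le x (Finset.mem_univ j)
    rw [hk, hi]
    have h := lt_mul_of_equal_means (x := fun j => (y j)⁻¹) (y := fun j => (x j)⁻¹)
      (M := (x k)⁻¹) hN (fun j => inv_pos.2 (hy j)) (fun j => inv_pos.2 (hx j)) hharm.symm
      (by rw [Finset.prod_inv_distrib, Finset.prod_inv_distrib, hprod])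
      (by simpa only [inv_inv] using hsum.symm)
      (fun j => inv_anti₀ (hx k) (hkmin j)) i
    rwa [← div_eq_mul_inv, lt_div_iff₀ (hx k), inv_mul_eq_div, div_lt_iff₀ (hy i)] at h
end

section
/- Let N ≥ 3 be an integer and let x_1,…,x_N, y_1,…,y_N be nonnegative real numbers with ∑_{j=1}^N x_j = ∑_{j=1}^N y_j and ∏_{j=1}^N x_j = ∏_{j=1}^N y_j. Then max_j x_j = (N−1) · max_j y_j holds if and only if there exists c ≥ 0 such that some x_i equals c·(N−1) and x_j = 0 for all j ≠ i, and there exists an index k with y_k = 0 and y_j = c for all j ≠ k. -/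
/-- Weierstrass product inequality for numbers in `[0, 1]`. -/
theorem one_sub_sum_one_sub_le_prod {ι : Type*} (s : Finset ι) (u : ι → ℝ)
    (h0 : ∀ j ∈ s, 0 ≤ u j) (h1 : ∀ j ∈ s, u j ≤ 1) :
    1 - ∑ j ∈ s, (1 - u j) ≤ ∏ j ∈ s, u j ∧ ∏ j ∈ s, u j ≤ 1 := by
  classical
  induction s using Finset.induction_on with
  | empty => simp
  | insert a s ha ih =>
    obtain ⟨ih1, ih2⟩ := ih (fun j hj => h0 j (Finset.mem_insert_of_mem hj))
      (fun j hj => h1 j (Finset.mem_insert_of_mem hj))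
    have ha0 := h0 a (Finset.mem_insert_self a s)
    have ha1 := h1 a (Finset.mem_insert_self a s)
    rw [Finset.sum_insert ha, Finset.prod_insert ha]
    constructor <;> nlinarith

/-- If nonnegative numbers sum to `#s * a` with `0 < a`, their product is at most `a ^ #s`. -/
theorem prod_le_mean_pow_card {ι : Type*} (s : Finset ι) (z : ι → ℝ) (a : ℝ) (ha : 0 < a)
    (h0 : ∀ j ∈ s, 0 ≤ z j) (hsum : ∑ j ∈ s, z j = s.card * a) :
    ∏ j ∈ s, z j ≤ a ^ s.card := by
  calc ∏ j ∈ s, z j ≤ ∏ j ∈ s, a * Real.exp (z j / a - 1) := by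
        refine Finset.prod_le_prod h0 fun j _ => ?_
        have h := Real.add_one_le_exp (z j / a - 1)
        calc z j = a * (z j / a) := by field_simp
          _ ≤ _ := mul_le_mul_of_nonneg_left (by linarith) ha.le
    _ = a ^ s.card := by
        rw [Finset.prod_mul_distrib, ← Real.exp_sum, Finset.sum_sub_distrib, ← Finset.sum_div,
          hsum, mul_div_cancel_right₀ _ ha.ne']
        simp

/-- If the values of `x` and `y` have equal sums and products, `y ≤ M` and `x i = (N - 1) * M`,
then all other values of `x` vanish. -/
theorem sum_erase_eq_zero_of_extremal {N : ℕ} (hN : 3 ≤ N) {x y : Fin N → ℝ}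
    (hx : ∀ j, 0 ≤ x j) (hy : ∀ j, 0 ≤ y j)
    (hsum : ∑ j, x j = ∑ j, y j) (hprod : ∏ j, x j = ∏ j, y j)
    {M : ℝ} (hM : 0 ≤ M) (hyM : ∀ j, y j ≤ M) {i : Fin N} (hi : x i = ((N : ℝ) - 1) * M) :
    ∑ j ∈ Finset.univ.erase i, x j = 0 := by
  obtain ⟨m, rfl⟩ : ∃ m, N = m + 3 := ⟨N - 3, by omega⟩
  set r := ∑ j ∈ Finset.univ.erase i, x j with hr
  have hr0 : 0 ≤ r := Finset.sum_nonneg fun j _ => hx j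
  have hxsum : x i + r = ∑ j, y j := by
    rw [← hsum, hr, Finset.add_sum_erase _ _ (Finset.mem_univ i)]
  have hyle : ∑ j, y j ≤ ((m + 3 : ℕ) : ℝ) * M := by
    simpa using Finset.sum_le_card_nsmul Finset.univ y M fun j _ => hyM j
  push_cast at hi hyle
  have hrM : r ≤ M := by linarith
  by_contra hne
  have hrpos : 0 < r := lt_of_le_of_ne hr0 (Ne.symm hne)
  have hMpos : 0 < M := hrpos.trans_le hrM
  have hcard : (Finset.univ.erase i).card = m + 2 := by
    simp [Finset.card_erase_of_mem]
  have hm : (0 : ℝ) < m + 2 := by positivity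
  have hup : ∏ j, x j ≤ ((m + 2) * M) * (r / (m + 2)) ^ (m + 2) := by
    rw [← Finset.mul_prod_erase _ _ (Finset.mem_univ i), hi]
    have h := prod_le_mean_pow_card (Finset.univ.erase i) x (r / (m + 2)) (by positivity)
      (fun j _ => hx j) (by rw [hcard, ← hr]; push_cast; field_simp)
    rw [hcard] at h
    calc _ ≤ ((m : ℝ) + 3 - 1) * M * (r / (m + 2)) ^ (m + 2) :=
          mul_le_mul_of_nonneg_left h (mul_nonneg (by linarith) hM)
      _ = _ := by ring
  have hlow : M ^ (m + 2) * r ≤ ∏ j, y j := by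
    have h := (one_sub_sum_one_sub_le_prod Finset.univ (fun j => y j / M)
      (fun j _ => div_nonneg (hy j) hM) (fun j _ => (div_le_one hMpos).2 (hyM j))).1
    rw [Finset.prod_div_distrib, Finset.sum_sub_distrib, ← Finset.sum_div, ← hxsum, hi] at h
    simp only [Finset.prod_const, Finset.sum_const, Finset.card_univ, Fintype.card_fin,
      nsmul_eq_mul, mul_one] at h
    rw [le_div_iff₀ (by positivity)] at h
    refine le_trans (le_of_eq ?_) h
    push_cast
    field_simp
    ring
  have hlt : (r / (m + 2)) ^ (m + 1) < M ^ (m + 1) := by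
    refine pow_lt_pow_left₀ ?_ (by positivity) (by omega)
    rw [div_lt_iff₀ hm]
    nlinarith
  have hle : M * r * M ^ (m + 1) ≤ M * r * (r / (m + 2)) ^ (m + 1) := by
    calc M * r * M ^ (m + 1) = M ^ (m + 2) * r := by ring
      _ ≤ ((m + 2) * M) * (r / (m + 2)) ^ (m + 2) := hlow.trans (hprod ▸ hup)
      _ = _ := by rw [pow_succ _ (m + 1)]; field_simp
  exact absurd (le_of_mul_le_mul_left hle (by positivity)) (not_le.2 hlt)

theorem three_mean_equality_case (N : ℕ) (hN : 3 ≤ N) (x y : Fin N → ℝ)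
    (hx : ∀ j, 0 ≤ x j) (hy : ∀ j, 0 ≤ y j)
    (hsum : ∑ j, x j = ∑ j, y j)
    (hprod : ∏ j, x j = ∏ j, y j) :
    Finset.univ.sup' ⟨⟨0, by omega⟩, Finset.mem_univ _⟩ x
        = ((N : ℝ) - 1) * Finset.univ.sup' ⟨⟨0, by omega⟩, Finset.mem_univ _⟩ y
      ↔ ∃ c : ℝ, 0 ≤ c ∧
          (∃ i : Fin N, x i = c * ((N : ℝ) - 1) ∧ ∀ j, j ≠ i → x j = 0) ∧
          (∃ k : Fin N, y k = 0 ∧ ∀ j, j ≠ k → y j = c) := by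
  have hN' : (3 : ℝ) ≤ N := by exact_mod_cast hN
  have : Nontrivial (Fin N) := Fin.nontrivial_iff_two_le.2 (by omega)
  have hne : (Finset.univ : Finset (Fin N)).Nonempty := ⟨⟨0, by omega⟩, Finset.mem_univ _⟩
  constructor
  · intro h
    obtain ⟨i, -, hi⟩ := Finset.exists_mem_eq_sup' hne x
    have hyM : ∀ j, y j ≤ Finset.univ.sup' hne y := fun j =>
      Finset.le_sup' y (Finset.mem_univ j)
    set M := Finset.univ.sup' hne y
    have hxi : x i = ((N : ℝ) - 1) * M := hi.symm.trans h
    have hM : 0 ≤ M := (hy i).trans (hyM i)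
    have hr := sum_erase_eq_zero_of_extremal hN hx hy hsum hprod hM hyM hxi
    have hx0 : ∀ j, j ≠ i → x j = 0 := fun j hj =>
      (Finset.sum_eq_zero_iff_of_nonneg fun j _ => hx j).1 hr j (by simp [hj])
    obtain ⟨j, hj⟩ := exists_ne i
    obtain ⟨k, -, hk⟩ := Finset.prod_eq_zero_iff.1
      (hprod.symm.trans (Finset.prod_eq_zero (Finset.mem_univ j) (hx0 j hj)))
    refine ⟨M, hM, ⟨i, by rw [hxi, mul_comm], hx0⟩, k, hk, fun j hj => ?_⟩
    have hysum : ∑ j ∈ Finset.univ.erase k, y j = ∑ j ∈ Finset.univ.erase k, M := by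
      have h1 := Finset.add_sum_erase _ x (Finset.mem_univ i)
      have h2 := Finset.add_sum_erase _ y (Finset.mem_univ k)
      rw [Finset.sum_const, Finset.card_erase_of_mem (Finset.mem_univ k), Finset.card_univ,
        Fintype.card_fin, nsmul_eq_mul, Nat.cast_sub (by omega), Nat.cast_one]
      linarith
    exact (Finset.sum_eq_sum_iff_of_le fun j _ => hyM j).1 hysum j (by simp [hj])
  · rintro ⟨c, hc, ⟨i, hi, hx0⟩, k, hk, hyc⟩
    have h1 : Finset.univ.sup' hne x = c * ((N : ℝ) - 1) := by
      refine le_antisymm (Finset.sup'_le _ _ fun j _ => ?_)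
        (hi ▸ Finset.le_sup' x (Finset.mem_univ i))
      rcases eq_or_ne j i with rfl | hj
      · exact hi.le
      · rw [hx0 j hj]
        exact mul_nonneg hc (by linarith)
    have h2 : Finset.univ.sup' hne y = c := by
      obtain ⟨l, hl⟩ := exists_ne k
      refine le_antisymm (Finset.sup'_le _ _ fun j _ => ?_)
        (hyc l hl ▸ Finset.le_sup' y (Finset.mem_univ l))
      rcases eq_or_ne j k with rfl | hj
      · exact hk.trans_le hc
      · exact (hyc j hj).le
    rw [h1, h2, mul_comm]
end

section
/- Let N ≥ 4 be an integer. Suppose x_1,…,x_N, y_1,…,y_N are real numbers satisfying the constraints: x_j ≥ 0 for all j; y_1 = 1 and 0 ≤ y_j ≤ 1 for 2 ≤ j ≤ N; ∑_{j=1}^N x_j = ∑_{j=1}^N y_j; ∏_{j=1}^N x_j = ∏_{j=1}^N y_j; and ∑_{k=1}^N ∏_{j≠k} x_j = ∑_{k=1}^N ∏_{j≠k} y_j. Then x_1 ≤ N−2, and x_1 = N−2 if and only if x_2 = ⋯ = x_N = 0 and exactly two of the y_j equal 0 while all the others equal 1. -/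
/-- The sum of the products of all but one of the `f j`, when one index is added. -/
theorem sum_prod_erase_insert {ι : Type*} [DecidableEq ι] (f : ι → ℝ) {a : ι} {t : Finset ι}
    (ha : a ∉ t) :
    ∑ k ∈ insert a t, ∏ j ∈ (insert a t).erase k, f j
      = ∏ j ∈ t, f j + f a * ∑ k ∈ t, ∏ j ∈ t.erase k, f j := by
  rw [Finset.sum_insert ha, Finset.erase_insert ha, Finset.mul_sum]
  congr 1
  refine Finset.sum_congr rfl fun k hk => ?_
  have hak : a ≠ k := fun h => ha (h ▸ hk)
  rw [Finset.erase_insert_of_ne hak, Finset.prod_insert]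
  exact fun h => ha (Finset.mem_of_mem_erase h)

/-- If at least three nonnegative numbers have sum `s ≤ 2`, their product is at most `s² / (3m)`
and the sum of the products of all but one of them is at most `s² / m`. -/
theorem prod_and_sum_prod_erase_le {ι : Type*} [DecidableEq ι] (f : ι → ℝ) (n : ℕ) :
    ∀ t : Finset ι, t.card = n + 3 → (∀ j ∈ t, 0 ≤ f j) → ∑ j ∈ t, f j ≤ 2 →
      3 * ((n : ℝ) + 3) * ∏ j ∈ t, f j ≤ (∑ j ∈ t, f j) ^ 2 ∧
      ((n : ℝ) + 3) * ∑ k ∈ t, ∏ j ∈ t.erase k, f j ≤ (∑ j ∈ t, f j) ^ 2 := by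
  induction n with
  | zero =>
    intro t ht hf hs
    obtain ⟨a, b, c, hab, hac, hbc, rfl⟩ := Finset.card_eq_three.1 ht
    have ha := hf a (by simp)
    have hb := hf b (by simp)
    have hc := hf c (by simp)
    have hbc' : b ∉ ({c} : Finset ι) := by simpa using hbc
    have habc : a ∉ ({b, c} : Finset ι) := by simp [hab, hac]
    rw [sum_prod_erase_insert f habc, sum_prod_erase_insert f hbc']
    rw [Finset.sum_insert habc, Finset.sum_insert hbc', Finset.sum_singleton] at hs ⊢
    rw [Finset.prod_insert habc, Finset.prod_insert hbc', Finset.prod_singleton]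
    simp only [Finset.sum_singleton, Finset.erase_singleton, Finset.prod_empty]
    generalize f a = x at *
    generalize f b = y at *
    generalize f c = z at *
    have hpair : 3 * (x * y + y * z + z * x) ≤ (x + y + z) ^ 2 := by
      nlinarith [sq_nonneg (x - y), sq_nonneg (y - z), sq_nonneg (z - x)]
    have htriple : 9 * (x * y * z) ≤ (x + y + z) * (x * y + y * z + z * x) := by
      nlinarith [mul_nonneg ha (sq_nonneg (y - z)), mul_nonneg hb (sq_nonneg (z - x)),
        mul_nonneg hc (sq_nonneg (x - y))]
    have hpos : 0 ≤ x * y + y * z + z * x := by positivity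
    constructor
    · norm_num
      nlinarith
    · norm_num
      linarith
  | succ n ih =>
    intro t ht hf hs
    obtain ⟨a, t, hat, rfl, ht'⟩ := Finset.card_eq_succ.1 ht
    have ha := hf a (by simp)
    have hft : ∀ j ∈ t, 0 ≤ f j := fun j hj => hf j (by simp [hj])
    have hst : 0 ≤ ∑ j ∈ t, f j := Finset.sum_nonneg hft
    rw [Finset.sum_insert hat] at hs
    obtain ⟨hq, he⟩ := ih t ht' hft (by linarith)
    rw [sum_prod_erase_insert f hat, Finset.sum_insert hat, Finset.prod_insert hat]
    have hn : (0 : ℝ) ≤ n := n.cast_nonneg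
    push_cast
    generalize f a = z at *
    generalize (∑ j ∈ t, f j) = s at *
    generalize (∑ k ∈ t, ∏ j ∈ t.erase k, f j) = e at *
    generalize (∏ j ∈ t, f j) = q at *
    generalize (n : ℝ) = v at *
    have hcubic : 27 * (z * s ^ 2) ≤ 8 * (z + s) ^ 2 := by
      have h1 : 27 * (z * s ^ 2) ≤ 4 * (z + s) ^ 3 := by
        nlinarith [mul_nonneg (by linarith : 0 ≤ 4 * z + s) (sq_nonneg (s - 2 * z))]
      nlinarith [sq_nonneg (z + s)]
    have hle : s ^ 2 ≤ (z + s) ^ 2 := by nlinarith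
    have hzq : 3 * (v + 3) * (z * q) ≤ z * s ^ 2 := by nlinarith
    have hze : (v + 3) * (z * e) ≤ z * s ^ 2 := by nlinarith
    have hW : 0 ≤ (z + s) ^ 2 := sq_nonneg _
    generalize (z + s) ^ 2 = w at *
    have hv : 0 < v + 3 := by linarith
    have hzq' : z * q ≤ 8 / 27 * w / (3 * (v + 3)) := by
      rw [le_div_iff₀ (by positivity)]; linarith
    have hze' : z * e ≤ 8 / 27 * w / (v + 3) := by
      rw [le_div_iff₀ (by positivity)]; linarith
    have hq' : q ≤ w / (3 * (v + 3)) := by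
      rw [le_div_iff₀ (by positivity)]; linarith
    have hratio : (v + 4) * (w / (v + 3)) ≤ 4 / 3 * w := by
      rw [← mul_div_assoc, div_le_iff₀ hv]; nlinarith [mul_nonneg hn hW]
    have hsplit : w / (3 * (v + 3)) = w / (v + 3) / 3 := by field_simp
    have hsplit' : 8 / 27 * w / (3 * (v + 3)) = 8 / 81 * (w / (v + 3)) := by field_simp; ring
    have hsplit'' : 8 / 27 * w / (v + 3) = 8 / 27 * (w / (v + 3)) := by field_simp
    rw [hsplit] at hq'
    rw [hsplit'] at hzq'
    rw [hsplit''] at hze'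
    constructor
    · have := mul_le_mul_of_nonneg_left hzq' (by linarith : 0 ≤ v + 4)
      linarith
    · have := mul_le_mul_of_nonneg_left (add_le_add hq' hze') (by linarith : 0 ≤ v + 4)
      linarith

/-- Lower bounds, for numbers in `[0, 1]`, on the product, and the range and a lower bound of the
sum of the products of all but one of them. -/
theorem unit_interval_prod_bounds {ι : Type*} [DecidableEq ι] (f : ι → ℝ) (t : Finset ι)
    (hf : ∀ j ∈ t, 0 ≤ f j ∧ f j ≤ 1) :
    0 ≤ ∏ j ∈ t, f j ∧
    ∑ j ∈ t, f j - t.card + 1 ≤ ∏ j ∈ t, f j ∧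
    ∑ k ∈ t, ∏ j ∈ t.erase k, f j ≤ t.card ∧
    t.card - (t.card - 1) * (t.card - ∑ j ∈ t, f j) ≤ ∑ k ∈ t, ∏ j ∈ t.erase k, f j := by
  induction t using Finset.induction_on with
  | empty => simp
  | insert a t hat ih =>
    obtain ⟨hp0, hp, he, hl⟩ := ih fun j hj => hf j (by simp [hj])
    obtain ⟨ha0, ha1⟩ := hf a (by simp)
    have hp1 : ∏ j ∈ t, f j ≤ 1 := Finset.prod_le_one
      (fun j hj => (hf j (by simp [hj])).1) fun j hj => (hf j (by simp [hj])).2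
    have he0 : 0 ≤ ∑ k ∈ t, ∏ j ∈ t.erase k, f j := Finset.sum_nonneg fun k _ =>
      Finset.prod_nonneg fun j hj => (hf j (by simp [Finset.mem_of_mem_erase hj])).1
    rw [sum_prod_erase_insert f hat, Finset.sum_insert hat, Finset.prod_insert hat,
      Finset.card_insert_of_notMem hat]
    push_cast
    refine ⟨mul_nonneg ha0 hp0, by nlinarith, by nlinarith, by nlinarith⟩

/-- For at least two numbers in `[0, 1]`, the sum of the products of all but one of them is at
least `2 - ∑ (1 - f j)`. -/
theorem sum_sub_card_add_two_le_sum_prod_erase {ι : Type*} [DecidableEq ι] (f : ι → ℝ) (n : ℕ) :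
    ∀ t : Finset ι, t.card = n + 2 → (∀ j ∈ t, 0 ≤ f j ∧ f j ≤ 1) →
      ∑ j ∈ t, f j - n ≤ ∑ k ∈ t, ∏ j ∈ t.erase k, f j := by
  induction n with
  | zero =>
    intro t ht _
    obtain ⟨a, b, hab, rfl⟩ := Finset.card_eq_two.1 ht
    have hab' : a ∉ ({b} : Finset ι) := by simpa using hab
    rw [sum_prod_erase_insert f hab', Finset.sum_insert hab']
    simp [add_comm]
  | succ n ih =>
    intro t ht hf
    obtain ⟨a, t, hat, rfl, ht'⟩ := Finset.card_eq_succ.1 ht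
    have hft : ∀ j ∈ t, 0 ≤ f j ∧ f j ≤ 1 := fun j hj => hf j (by simp [hj])
    obtain ⟨ha0, ha1⟩ := hf a (by simp)
    have he := ih t ht' hft
    obtain ⟨hp0, hp, -, -⟩ := unit_interval_prod_bounds f t hft
    rw [sum_prod_erase_insert f hat, Finset.sum_insert hat]
    rw [ht'] at hp
    push_cast at hp ⊢
    nlinarith

/-- The scalar inequalities that force the extremal configuration. -/
theorem extremal_of_scalar_bounds {M X s u E F : ℝ} (hM : 3 ≤ M) (hX : M - 1 ≤ X) (hs : 0 ≤ s)
    (hu : u ≤ 2) (hXs : X + s = M - 1 + u) (hE : M * E ≤ s ^ 2) (hEF : F ≤ X * E)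
    (hF : u ≤ F) (hF' : M - (M - 1) * (2 - u) ≤ F) : s = 0 ∧ u = 0 := by
  have hsu : s ≤ u := by linarith
  rcases eq_or_lt_of_le (hs.trans hsu) with hu0 | hu0
  · exact ⟨by linarith, hu0.symm⟩
  exfalso
  have hXsle : X * s ≤ (M - 1) * u := by
    obtain rfl : X = M - 1 + u - s := by linarith
    nlinarith
  have hFle : M * F ≤ (M - 1) * u ^ 2 := by
    calc M * F ≤ M * (X * E) := by gcongr
      _ = X * (M * E) := by ring
      _ ≤ X * s ^ 2 := by gcongr; linarith
      _ = X * s * s := by ring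
      _ ≤ (M - 1) * u * u := mul_le_mul hXsle hsu hs (mul_nonneg (by linarith) hu0.le)
      _ = (M - 1) * u ^ 2 := by ring
  have hlow : M ≤ (M - 1) * u := by
    have : M * u ≤ (M - 1) * u * u := by nlinarith
    exact le_of_mul_le_mul_right this hu0
  have hquad : 0 ≤ (M - 1) * u ^ 2 - M * (M - 1) * u + M * (M - 2) := by nlinarith
  have hchord : 0 ≤ ((M - 1) * u - M) * (2 - u) :=
    mul_nonneg (by linarith) (by linarith)
  have hlin : 0 ≤ M ^ 2 - 4 * M - (M ^ 2 - 4 * M + 2) * u := by nlinarith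
  nlinarith [mul_nonneg (by linarith : 0 ≤ M - 3) (by linarith : 0 ≤ M - 3)]

theorem four_mean_optimization (N : ℕ) (hN : 4 ≤ N) (x y : Fin N → ℝ)
    (hx : ∀ j, 0 ≤ x j)
    (hy1 : y ⟨0, by omega⟩ = 1)
    (hy : ∀ j, 0 ≤ y j ∧ y j ≤ 1)
    (hsum : ∑ j, x j = ∑ j, y j)
    (hprod : ∏ j, x j = ∏ j, y j)
    (hesym : ∑ k, ∏ j ∈ Finset.univ.erase k, x j
      = ∑ k, ∏ j ∈ Finset.univ.erase k, y j) :
    x ⟨0, by omega⟩ ≤ (N : ℝ) - 2 ∧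
      (x ⟨0, by omega⟩ = (N : ℝ) - 2 ↔
        (∀ j, j ≠ ⟨0, by omega⟩ → x j = 0) ∧
        (∃ S : Finset (Fin N), S.card = 2 ∧ (∀ j ∈ S, y j = 0) ∧
          ∀ j ∉ S, y j = 1)) := by
  obtain ⟨n, rfl⟩ := Nat.exists_eq_add_of_le' hN
  generalize hi : (⟨0, by omega⟩ : Fin (n + 4)) = i at *
  set t : Finset (Fin (n + 4)) := Finset.univ.erase i with ht
  have hit : i ∉ t := Finset.notMem_erase i _
  have huniv : (Finset.univ : Finset (Fin (n + 4))) = insert i t := by simp [ht]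
  have htcard : t.card = n + 3 := by simp [ht]
  have hsum' := hsum
  have hn : (0 : ℝ) ≤ n := n.cast_nonneg
  have key : (n : ℝ) + 2 ≤ x i → ∑ j ∈ t, x j = 0 ∧ ∑ j ∈ t, y j = n + 1 := by
    intro hX
    rw [huniv] at hprod hesym hsum'
    rw [sum_prod_erase_insert x hit, sum_prod_erase_insert y hit] at hesym
    rw [Finset.prod_insert hit, Finset.prod_insert hit] at hprod
    rw [Finset.sum_insert hit, Finset.sum_insert hit] at hsum'
    rw [hy1] at hprod hesym hsum'
    have hq : 0 ≤ ∏ j ∈ t, x j := Finset.prod_nonneg fun j _ => hx j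
    have hs : 0 ≤ ∑ j ∈ t, x j := Finset.sum_nonneg fun j _ => hx j
    have hyle : ∑ j ∈ t, y j ≤ n + 3 := by
      have := Finset.sum_le_card_nsmul t y 1 fun j _ => (hy j).2
      simpa [htcard] using this
    have hE := (prod_and_sum_prod_erase_le x n t htcard (fun j _ => hx j) (by linarith)).2
    have hF := sum_sub_card_add_two_le_sum_prod_erase y (n + 1) t htcard fun j _ => hy j
    obtain ⟨-, -, -, hF'⟩ := unit_interval_prod_bounds y t fun j _ => hy j
    rw [htcard] at hF'
    push_cast at hF hF'
    have := extremal_of_scalar_bounds (M := n + 3) (X := x i) (s := ∑ j ∈ t, x j)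
      (u := ∑ j ∈ t, y j - (n + 1)) (by linarith) (by linarith) hs (by linarith) (by linarith)
      hE (F := ∑ k ∈ t, ∏ j ∈ t.erase k, y j) (by nlinarith) (by linarith) (by linarith)
    exact ⟨this.1, by linarith [this.2]⟩
  rw [huniv, Finset.sum_insert hit, Finset.sum_insert hit, hy1] at hsum
  push_cast
  refine ⟨?_, fun h => ?_, ?_⟩
  · by_contra! h
    obtain ⟨h1, h2⟩ := key (by linarith)
    linarith
  · obtain ⟨h1, h2⟩ := key (by linarith)
    have hx0 : ∀ j ∈ t, x j = 0 := (Finset.sum_eq_zero_iff_of_nonneg fun j _ => hx j).1 h1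
    refine ⟨fun j hj => hx0 j (by simp [ht, hj]), ?_⟩
    have hxe : ∑ k, ∏ j ∈ Finset.univ.erase k, x j = 0 := by
      refine Finset.sum_eq_zero fun k _ => ?_
      obtain ⟨j, hj⟩ : (t.erase k).Nonempty := by
        rw [← Finset.card_pos]
        have := Finset.pred_card_le_card_erase (s := t) (a := k)
        omega
      rw [Finset.mem_erase] at hj
      exact Finset.prod_eq_zero (Finset.mem_erase.2 ⟨hj.1, Finset.mem_univ j⟩) (hx0 j hj.2)
    rw [hxe, eq_comm, Finset.sum_eq_zero_iff_of_nonneg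
      fun k _ => Finset.prod_nonneg fun j _ => (hy j).1] at hesym
    have hzero : ∀ k, ∃ j, j ≠ k ∧ y j = 0 := by
      intro k
      obtain ⟨j, hj, hj0⟩ := Finset.prod_eq_zero_iff.1 (hesym k (Finset.mem_univ k))
      exact ⟨j, (Finset.mem_erase.1 hj).1, hj0⟩
    obtain ⟨a, -, ha0⟩ := hzero i
    obtain ⟨b, hba, hb0⟩ := hzero a
    refine ⟨{a, b}, Finset.card_pair hba.symm, by simp [ha0, hb0], ?_⟩
    have hcompl : ∑ j ∈ ({a, b} : Finset (Fin (n + 4)))ᶜ, (1 - y j) = 0 := by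
      have hall := Finset.sum_add_sum_compl ({a, b} : Finset (Fin (n + 4))) fun j => 1 - y j
      rw [Finset.sum_pair hba.symm, ha0, hb0, Finset.sum_sub_distrib (s := Finset.univ)] at hall
      have hytot : ∑ j, y j = n + 2 := by
        rw [huniv, Finset.sum_insert hit, hy1, h2]; ring
      rw [hytot] at hall
      simp only [Finset.sum_const, Finset.card_univ, Fintype.card_fin, nsmul_eq_mul] at hall
      push_cast at hall
      linarith
    intro j hj
    have := (Finset.sum_eq_zero_iff_of_nonneg fun j _ => sub_nonneg.2 (hy j).2).1 hcompl j
      (Finset.mem_compl.2 hj)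
    linarith
  · rintro ⟨hx0, S, hS, hS0, hS1⟩
    have hxt : ∑ j ∈ t, x j = 0 :=
      Finset.sum_eq_zero fun j hj => hx0 j (Finset.mem_erase.1 hj).1
    have hytot : ∑ j, y j = n + 2 := by
      rw [← Finset.sum_add_sum_compl S, Finset.sum_eq_zero hS0,
        Finset.sum_congr rfl fun j hj => hS1 j (Finset.mem_compl.1 hj)]
      simp [Finset.card_compl, hS]
    rw [huniv, Finset.sum_insert hit, hy1] at hytot
    linarith
end
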